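/- For every r ∈ (0, 1], ((1 − 3r⁴)² + (1 − 2r²)²) / (r·√(36r⁴ + 4)) > 0.0061. -/

import Mathlib

open Set

theorem quartic_pos (s : ℝ) :
    0.0061 * ((s * (36 * s ^ 2 + 4) / (35 / 12) + 35 / 12) / 2)
      < (1 - 3 * s ^ 2) ^ 2 + (1 - 2 * s) ^ 2 := by
  nlinarith [sq_nonneg (s ^ 2 - 2 * (0.0061 * 6 / 35) * s - 0.3108), sq_nonneg (s - 0.5586)]

/-- Numerical bound from the Wermer-disc example:
`((1-3r⁴)² + (1-2r²)²)/(r√(36r⁴+4)) > 0.0061` for all `r ∈ (0,1]`. -/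
theorem stmt_16 :
    ∀ r ∈ Ioc (0:ℝ) 1,
      ((1 - 3 * r ^ 4) ^ 2 + (1 - 2 * r ^ 2) ^ 2) / (r * Real.sqrt (36 * r ^ 4 + 4))
        > 0.0061 := by
  rintro r ⟨hr, -⟩
  have hpos : 0 < Real.sqrt (36 * r ^ 4 + 4) := Real.sqrt_pos.2 (by positivity)
  rw [gt_iff_lt, lt_div_iff₀ (mul_pos hr hpos)]
  have hsq := Real.sq_sqrt (show 0 ≤ 36 * r ^ 4 + 4 by positivity)
  set y := Real.sqrt (36 * r ^ 4 + 4)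
  have hq := quartic_pos (r ^ 2)
  -- AM-GM, tangent to the square root near the minimiser
  have hprod : (r * y) ^ 2 = r ^ 2 * (36 * (r ^ 2) ^ 2 + 4) := by
    rw [mul_pow, hsq]; ring
  rw [← hprod] at hq
  have hr4 : (r ^ 2) ^ 2 = r ^ 4 := by ring
  rw [hr4] at hq
  linarith [sq_nonneg (r * y - 35 / 12)]
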